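/- Let R be a commutative Noetherian local ring, N a nonzero finitely generated R-module, n ≥ 1, M = Ω_R^n N, and x₁,…,x_n an R-regular sequence annihilating Ext_R^1(N, Ω_R N). Then Ω_R^n(M/(x₁,…,x_n)M) ≅ ⊕_{i=0}^{n} (Ω_R^i M)^{⊕ C(n,i)} up to free direct summands. -/

import Mathlib

open CategoryTheory IsLocalRing

section Defs
variable (R : Type) [CommRing R]

/-- vanishing of `Tor_n(M, N)` -/
noncomputable abbrev TorZero [IsNoetherianRing R] (n : ℕ) (M N : ModuleCat.{0} R) : Prop :=
  Subsingleton (((Tor (ModuleCat.{0} R) n).obj M).obj N)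

/-- vanishing of `Ext^n(M, N)` -/
noncomputable abbrev ExtZero (n : ℕ) (M N : ModuleCat.{0} R) : Prop :=
  Subsingleton (((Ext R (ModuleCat.{0} R) n).obj (Opposite.op M)).obj N)

/-- `x` annihilates `Ext^n(M, N)` -/
noncomputable abbrev SMulExtZero (x : R) (n : ℕ) (M N : ModuleCat.{0} R) : Prop :=
  ∀ e : ((Ext R (ModuleCat.{0} R) n).obj (Opposite.op M)).obj N, x • e = 0

/-- `M` is a minimal first syzygy `Ω N` of `N` over the local ring `R`:
the kernel of a minimal free cover of `N`. -/
def IsSyzygyOf [IsLocalRing R] (N M : ModuleCat.{0} R) : Prop :=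
  ∃ (q : ℕ) (g : (Fin q → R) →ₗ[R] N), Function.Surjective g ∧
    (LinearMap.ker g : Submodule R (Fin q → R)) ≤ (maximalIdeal R) • ⊤ ∧
    Nonempty (M ≃ₗ[R] LinearMap.ker g)

/-- `M` is a minimal `n`-th syzygy `Ω^n N` of `N` (with `Ω^0 N = N`). -/
def IsNthSyzygyOf [IsLocalRing R] : ℕ → ModuleCat.{0} R → ModuleCat.{0} R → Prop
  | 0, N, M => Nonempty (M ≃ₗ[R] N)
  | (n+1), N, M => ∃ K : ModuleCat.{0} R, IsSyzygyOf R N K ∧ IsNthSyzygyOf n K M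

/-- `M` and `N` are stably isomorphic (isomorphic up to free direct summands). -/
def StablyIso (M N : ModuleCat.{0} R) : Prop :=
  ∃ p q : ℕ, Nonempty ((↥M × (Fin p → R)) ≃ₗ[R] (↥N × (Fin q → R)))

/-- Tor-rigidity: one vanishing Tor (against any f.g. module) forces all higher ones. -/
noncomputable def TorRigid [IsNoetherianRing R] (M : ModuleCat.{0} R) : Prop :=
  ∀ (N : ModuleCat.{0} R), Module.Finite R N →
    ∀ i : ℕ, 1 ≤ i → TorZero R i M N → ∀ j, i ≤ j → TorZero R j M N

/-- `n`-Tor-rigidity: `n` consecutive vanishing Tor's force all higher ones. -/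
noncomputable def NTorRigid [IsNoetherianRing R] (n : ℕ) (M : ModuleCat.{0} R) : Prop :=
  ∀ (N : ModuleCat.{0} R), Module.Finite R N → ∀ t : ℕ,
    (∀ i, t + 1 ≤ i → i ≤ t + n → TorZero R i M N) → ∀ j, t + 1 ≤ j → TorZero R j M N

/-- the `𝔞`-depth of `M`: `∞` if `𝔞M = M`, otherwise the supremum (= common length) of
maximal `M`-regular sequences contained in `𝔞`. -/
noncomputable def edepth (𝔞 : Ideal R) (M : Type) [AddCommGroup M] [Module R M] : ℕ∞ :=
  letI := Classical.dec (𝔞 • (⊤ : Submodule R M) = ⊤)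
  if 𝔞 • (⊤ : Submodule R M) = ⊤ then ⊤
  else sSup {n : ℕ∞ | ∃ rs : List R, (rs.length : ℕ∞) = n ∧ (∀ r ∈ rs, r ∈ 𝔞) ∧
    RingTheory.Sequence.IsRegular M rs}

/-- `T` is an Auslander transpose of `N`, computed from a minimal free presentation. -/
def IsTransposeOf [IsLocalRing R] (N T : ModuleCat.{0} R) : Prop :=
  ∃ (q p : ℕ) (g : (Fin q → R) →ₗ[R] N) (f : (Fin p → R) →ₗ[R] (Fin q → R)),
    Function.Surjective g ∧
    LinearMap.range f = LinearMap.ker g ∧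
    (LinearMap.ker g : Submodule R (Fin q → R)) ≤ (maximalIdeal R) • ⊤ ∧
    (LinearMap.ker f : Submodule R (Fin p → R)) ≤ (maximalIdeal R) • ⊤ ∧
    Nonempty (T ≃ₗ[R] (Module.Dual R (Fin p → R) ⧸ LinearMap.range f.dualMap))

/-- `depth (R_𝔭)`, the depth of the local ring `R_𝔭`. -/
noncomputable def depthLoc (𝔭 : Ideal R) [𝔭.IsPrime] : ℕ∞ :=
  edepth (Localization.AtPrime 𝔭) (maximalIdeal (Localization.AtPrime 𝔭)) (Localization.AtPrime 𝔭)

/-- `depth_{R_𝔭} (M_𝔭)`, the depth of the localized module over the localized ring. -/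
noncomputable def primeDepth (𝔭 : Ideal R) [𝔭.IsPrime] (M : Type) [AddCommGroup M]
    [Module R M] : ℕ∞ :=
  edepth (Localization.AtPrime 𝔭) (maximalIdeal (Localization.AtPrime 𝔭))
    (LocalizedModule 𝔭.primeCompl M)

/-- A Noetherian local ring is Gorenstein iff `R` has finite injective dimension as an
`R`-module, i.e. `Ext^i(k, R) = 0` for all sufficiently large `i`. -/
noncomputable def IsGorensteinLocal [IsLocalRing R] : Prop :=
  ∃ d : ℕ, ∀ i : ℕ, d < i → ExtZero R i (ModuleCat.of R (R ⧸ maximalIdeal R)) (ModuleCat.of R R)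

/-- An unramified regular local ring: the maximal ideal is generated by `dim R` elements, and
no rational prime that is a nonzero element of the maximal ideal lies in its square. -/
def IsUnramifiedRegularLocal [IsLocalRing R] : Prop :=
  (∃ s : Finset R, Ideal.span (s : Set R) = maximalIdeal R ∧
    (s.card : WithBot ℕ∞) = ringKrullDim R) ∧
  ∀ p : ℕ, p.Prime → (p : R) ≠ 0 → (p : R) ∈ maximalIdeal R → (p : R) ∉ (maximalIdeal R) ^ 2

end Defs

namespace SyzAux

section Unbundled

variable {R : Type} [CommRing R]
variable {A B C D A' B' : Type} [AddCommGroup A] [AddCommGroup B] [AddCommGroup C] [AddCommGroup D]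
  [AddCommGroup A'] [AddCommGroup B'] [Module R A] [Module R B] [Module R C] [Module R D]
  [Module R A'] [Module R B']

variable (R A B) in
/-- Stable isomorphism, unbundled. -/
def SI : Prop := ∃ p q : ℕ, Nonempty ((A × (Fin p → R)) ≃ₗ[R] (B × (Fin q → R)))

variable (R A B) in
/-- `B` is a (not necessarily minimal) first syzygy of `A`. -/
def Syz : Prop := ∃ (q : ℕ) (i : B →ₗ[R] (Fin q → R)) (g : (Fin q → R) →ₗ[R] A),
  Function.Injective i ∧ Function.Surjective g ∧ Function.Exact i g

variable (A) in
/-- multiplication by `y` on `A` factors through a finite free module. -/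
def SZ (y : R) : Prop := ∃ (q : ℕ) (a : A →ₗ[R] (Fin q → R)) (b : (Fin q → R) →ₗ[R] A),
  ∀ z, b (a z) = y • z

lemma exists_fin (F : Type) [AddCommGroup F] [Module R F] [Module.Finite R F] [Module.Free R F] :
    ∃ q : ℕ, Nonempty (F ≃ₗ[R] (Fin q → R)) := by
  cases subsingleton_or_nontrivial R
  · have := Module.subsingleton R F
    exact ⟨0, ⟨0, 0, fun x => Subsingleton.elim _ _, fun x => Subsingleton.elim _ _⟩⟩
  · exact ⟨_, ⟨(Module.finBasis R F).equivFun⟩⟩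

lemma SI.mk' {F G : Type} [AddCommGroup F] [Module R F] [Module.Finite R F] [Module.Free R F]
    [AddCommGroup G] [Module R G] [Module.Finite R G] [Module.Free R G]
    (e : (A × F) ≃ₗ[R] (B × G)) : SI R A B := by
  obtain ⟨p, ⟨f⟩⟩ := exists_fin (R := R) F
  obtain ⟨q, ⟨g⟩⟩ := exists_fin (R := R) G
  exact ⟨p, q, ⟨((LinearEquiv.refl R A).prodCongr f.symm).trans
    (e.trans ((LinearEquiv.refl R B).prodCongr g))⟩⟩

lemma SI.of_equiv (e : A ≃ₗ[R] B) : SI R A B :=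
  SI.mk' (F := Fin 0 → R) (G := Fin 0 → R) (e.prodCongr (LinearEquiv.refl R _))

lemma SI.symm (h : SI R A B) : SI R B A := by
  obtain ⟨p, q, ⟨e⟩⟩ := h
  exact ⟨q, p, ⟨e.symm⟩⟩

/-- composition of linear equivalences -/
abbrev ltr (e : A ≃ₗ[R] B) (f : B ≃ₗ[R] C) : A ≃ₗ[R] C := e.trans f

lemma SI.trans (h : SI R A B) (h' : SI R B C) : SI R A C := by
  obtain ⟨p, q, ⟨e⟩⟩ := h
  obtain ⟨p', q', ⟨e'⟩⟩ := h'
  refine SI.mk' (F := (Fin p → R) × (Fin p' → R)) (G := (Fin q' → R) × (Fin q → R)) ?_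
  refine ltr (LinearEquiv.prodAssoc R _ _ _).symm ?_
  refine ltr (e.prodCongr (LinearEquiv.refl R _)) ?_
  refine ltr (LinearEquiv.prodAssoc R _ _ _) ?_
  refine ltr ((LinearEquiv.refl R B).prodCongr (LinearEquiv.prodComm R _ _)) ?_
  refine ltr (LinearEquiv.prodAssoc R _ _ _).symm ?_
  refine ltr (e'.prodCongr (LinearEquiv.refl R _)) ?_
  exact (LinearEquiv.prodAssoc R _ _ _)

lemma SI.prod (h : SI R A B) (h' : SI R A' B') : SI R (A × A') (B × B') := by
  obtain ⟨p, q, ⟨e⟩⟩ := h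
  obtain ⟨p', q', ⟨e'⟩⟩ := h'
  refine SI.mk' (F := (Fin p → R) × (Fin p' → R)) (G := (Fin q → R) × (Fin q' → R)) ?_
  refine ltr (LinearEquiv.prodProdProdComm R _ _ _ _) ?_
  refine ltr (e.prodCongr e') ?_
  exact (LinearEquiv.prodProdProdComm R _ _ _ _)

lemma Syz.mk' {F : Type} [AddCommGroup F] [Module R F] [Module.Finite R F] [Module.Free R F]
    (i : B →ₗ[R] F) (g : F →ₗ[R] A) (hi : Function.Injective i) (hg : Function.Surjective g)
    (h : Function.Exact i g) : Syz R A B := by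
  obtain ⟨p, ⟨f⟩⟩ := exists_fin (R := R) F
  refine ⟨p, (f : F →ₗ[R] (Fin p → R)) ∘ₗ i, g ∘ₗ (f.symm : (Fin p → R) →ₗ[R] F), ?_, ?_, ?_⟩
  · exact f.injective.comp hi
  · exact hg.comp f.symm.surjective
  · intro z
    simp only [LinearMap.comp_apply, LinearEquiv.coe_coe, Set.mem_range]
    rw [h (f.symm z)]
    simp only [Set.mem_range, LinearEquiv.eq_symm_apply]

/-- split exact sequences -/
lemma split {P : Type} [AddCommGroup P] [Module R P] (i : B →ₗ[R] P) (g : P →ₗ[R] A)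
    (s : A →ₗ[R] P) (hi : Function.Injective i) (h : Function.Exact i g) (hs : ∀ z, g (s z) = z) :
    Nonempty ((B × A) ≃ₗ[R] P) :=
  ⟨lequivProdOfRightSplitExact (j := i) (g := g) (f := s) hi (LinearMap.exact_iff.1 h).symm
    (LinearMap.ext hs)⟩

/-- the pullback of `g` and `g'` -/
abbrev PB (g : A →ₗ[R] C) (g' : B →ₗ[R] C) : Submodule R (A × B) :=
  LinearMap.ker (g ∘ₗ LinearMap.fst R A B - g' ∘ₗ LinearMap.snd R A B)

lemma mem_PB (g : A →ₗ[R] C) (g' : B →ₗ[R] C) (z : A × B) : z ∈ PB g g' ↔ g z.1 = g' z.2 := by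
  simp [PB, sub_eq_zero]

lemma PB_split (g : A →ₗ[R] C) (g' : B →ₗ[R] C) (i : D →ₗ[R] A) (hi : Function.Injective i)
    (h : Function.Exact i g) (s : B →ₗ[R] A) (hs : ∀ b, g (s b) = g' b) :
    Nonempty ((D × B) ≃ₗ[R] PB g g') := by
  refine split (LinearMap.codRestrict _ (LinearMap.inl R A B ∘ₗ i) ?_)
    (LinearMap.snd R A B ∘ₗ (PB g g').subtype)
    (LinearMap.codRestrict _ (s.prod LinearMap.id) ?_) ?_ ?_ ?_
  · intro d
    rw [mem_PB]
    simpa using h.apply_apply_eq_zero d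
  · intro b
    rw [mem_PB]
    simpa using hs b
  · intro d d' hd
    have := congrArg (fun z : PB g g' => z.1.1) hd
    exact hi (by simpa using this)
  · rintro ⟨⟨a, b⟩, hz⟩
    rw [mem_PB] at hz
    simp only [LinearMap.comp_apply, Submodule.subtype_apply, LinearMap.snd_apply, Set.mem_range,
      Subtype.ext_iff, LinearMap.codRestrict_apply, LinearMap.inl_apply, Prod.mk.injEq]
    constructor
    · rintro rfl
      obtain ⟨d, rfl⟩ := (h a).1 (by simpa using hz)
      exact ⟨d, rfl, rfl⟩
    · rintro ⟨d, -, h⟩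
      exact h.symm
  · intro z
    rfl

lemma PB_comm (g : A →ₗ[R] C) (g' : B →ₗ[R] C) : Nonempty (PB g g' ≃ₗ[R] PB g' g) := by
  refine ⟨(LinearEquiv.prodComm R A B).ofSubmodules _ _ ?_⟩
  ext ⟨b, a⟩
  simp [sub_eq_zero]
  grind

lemma schanuel (h : Syz R A B) (h' : Syz R A B') : SI R B B' := by
  obtain ⟨q, i, g, hi, hg, hex⟩ := h
  obtain ⟨q', i', g', hi', hg', hex'⟩ := h'
  obtain ⟨s, hs⟩ := Module.projective_lifting_property g g' hg
  obtain ⟨s', hs'⟩ := Module.projective_lifting_property g' g hg'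
  obtain ⟨e⟩ := PB_split g g' i hi hex s (fun b => LinearMap.congr_fun hs b)
  obtain ⟨e'⟩ := PB_split g' g i' hi' hex' s' (fun b => LinearMap.congr_fun hs' b)
  obtain ⟨c⟩ := PB_comm g g'
  exact ⟨_, _, ⟨e.trans (c.trans e'.symm)⟩⟩

lemma Syz.prod (h : Syz R A B) (h' : Syz R A' B') : Syz R (A × A') (B × B') := by
  obtain ⟨q, i, g, hi, hg, hex⟩ := h
  obtain ⟨q', i', g', hi', hg', hex'⟩ := h'
  refine Syz.mk' (i.prodMap i') (g.prodMap g') (hi.prodMap hi') (hg.prodMap hg') ?_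
  rintro ⟨a, b⟩
  simp only [LinearMap.prodMap_apply, Prod.mk_eq_zero, Set.mem_range, Prod.exists, Prod.mk.injEq]
  rw [hex a, hex' b]
  simp

lemma Syz.prod_free (h : Syz R A B) (p : ℕ) : Syz R (A × (Fin p → R)) B := by
  obtain ⟨q, i, g, hi, hg, hex⟩ := h
  refine Syz.mk' (LinearMap.inl R _ (Fin p → R) ∘ₗ i) (g.prodMap LinearMap.id)
    (LinearMap.inl_injective.comp hi) (hg.prodMap Function.surjective_id) ?_
  rintro ⟨a, b⟩
  simp only [LinearMap.prodMap_apply, Prod.mk_eq_zero, Set.mem_range]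
  rw [hex a]
  simp [eq_comm]

lemma Syz.congr_left (h : Syz R A B) (e : A ≃ₗ[R] A') : Syz R A' B := by
  obtain ⟨q, i, g, hi, hg, hex⟩ := h
  refine ⟨q, i, e.toLinearMap ∘ₗ g, hi, e.surjective.comp hg, ?_⟩
  intro z
  simpa using hex z

lemma Syz.congr_right (h : Syz R A B) (e : B' ≃ₗ[R] B) : Syz R A B' := by
  obtain ⟨q, i, g, hi, hg, hex⟩ := h
  refine ⟨q, i ∘ₗ e.toLinearMap, g, hi.comp e.injective, hg, ?_⟩
  intro z
  rw [hex z]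
  simp [Set.mem_range, e.surjective.exists]

lemma Syz.si (h : Syz R A B) (h' : Syz R A' B') (hA : SI R A A') : SI R B B' := by
  obtain ⟨p, q, ⟨e⟩⟩ := hA
  exact schanuel ((h.prod_free p).congr_left e) (h'.prod_free q)

lemma Syz.exists_of_finite [IsNoetherianRing R] (A : Type) [AddCommGroup A] [Module R A]
    [Module.Finite R A] : ∃ (q : ℕ) (g : (Fin q → R) →ₗ[R] A), Function.Surjective g :=
  Module.Finite.exists_fin' R A

lemma SZ.lift {y : R} (h : SZ A y) (g : B →ₗ[R] A) (hg : Function.Surjective g) :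
    ∃ s : A →ₗ[R] B, ∀ z, g (s z) = y • z := by
  obtain ⟨q, a, b, hab⟩ := h
  obtain ⟨t, ht⟩ := Module.projective_lifting_property g b hg
  refine ⟨t ∘ₗ a, fun z => ?_⟩
  rw [← hab z, ← ht]
  rfl

lemma SZ.syz {y : R} (h : SZ A y) (hB : Syz R A B) : SZ B y := by
  obtain ⟨q, i, g, hi, hg, hex⟩ := hB
  obtain ⟨s, hs⟩ := h.lift g hg
  have key : ∀ f, y • f - s (g f) ∈ LinearMap.range i := by
    intro f
    have := (hex (y • f - s (g f))).1 (by simp [hs])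
    exact this
  let e := LinearEquiv.ofInjective i hi
  let b : (Fin q → R) →ₗ[R] B :=
    e.symm.toLinearMap ∘ₗ LinearMap.codRestrict _ (y • LinearMap.id - s ∘ₗ g) key
  refine ⟨q, i, b, fun z => ?_⟩
  apply hi
  have : ∀ f, i (b f) = y • f - s (g f) := by
    intro f
    have : e (b f) = ⟨y • f - s (g f), key f⟩ := by simp [b]; rfl
    exact congrArg Subtype.val this
  rw [this, hex.apply_apply_eq_zero]
  simp

lemma SZ.retract {y : R} (h : SZ A y) (i : B →ₗ[R] A) (r : A →ₗ[R] B) (hr : ∀ b, r (i b) = b) :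
    SZ B y := by
  obtain ⟨q, a, b, hab⟩ := h
  refine ⟨q, a ∘ₗ i, r ∘ₗ b, fun z => ?_⟩
  simp [hab, hr]

lemma SZ.prod {y : R} (h : SZ A y) (h' : SZ B y) : SZ (A × B) y := by
  obtain ⟨q, a, b, hab⟩ := h
  obtain ⟨q', a', b', hab'⟩ := h'
  obtain ⟨p, ⟨e⟩⟩ := exists_fin (R := R) ((Fin q → R) × (Fin q' → R))
  refine ⟨p, e.toLinearMap ∘ₗ a.prodMap a', b.prodMap b' ∘ₗ e.symm.toLinearMap, ?_⟩
  rintro ⟨z, w⟩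
  simp [hab, hab']

lemma SZ.si {y : R} (h : SZ A y) (hA : SI R A B) : SZ B y := by
  obtain ⟨p, q, ⟨e⟩⟩ := hA
  have h1 : SZ (Fin p → R) y := ⟨p, y • LinearMap.id, LinearMap.id, fun z => by simp⟩
  refine (h.prod h1).retract (e.symm.toLinearMap ∘ₗ LinearMap.inl R B (Fin q → R))
    (LinearMap.fst R B (Fin q → R) ∘ₗ e.toLinearMap) ?_
  intro b
  simp

/-- Multiplication by `y` as a linear map. -/
abbrev mulL (A : Type) [AddCommGroup A] [Module R A] (y : R) : A →ₗ[R] A := y • LinearMap.id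

lemma PB_syz {q q' : ℕ} (y : R) (g : (Fin q → R) →ₗ[R] A) (hg : Function.Surjective g)
    (i : B →ₗ[R] (Fin q → R)) (hi : Function.Injective i) (hex : Function.Exact i g)
    (h : (Fin q' → R) →ₗ[R] B) (hh : Function.Surjective h) :
    Syz R (PB g (mulL A y)) (PB h (mulL B y)) := by
  refine Syz.mk' (F := (Fin q' → R) × (Fin q → R))
    ((LinearMap.fst R _ _).prod (-(i ∘ₗ LinearMap.snd R _ _)) ∘ₗ (PB h (mulL B y)).subtype)
    (LinearMap.codRestrict _ (((i ∘ₗ h) ∘ₗ LinearMap.fst R _ _ + y • LinearMap.snd R _ _).prod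
      (g ∘ₗ LinearMap.snd R _ _)) ?_) ?_ ?_ ?_
  · rintro ⟨u, v⟩
    rw [mem_PB]
    simp [hex.apply_apply_eq_zero]
  · rintro ⟨⟨u, w⟩, hz⟩ ⟨⟨u', w'⟩, hz'⟩ he
    obtain rfl : u = u' := congrArg Prod.fst he
    have h2 : -(i w) = -(i w') := congrArg Prod.snd he
    obtain rfl := hi (neg_injective h2)
    rfl
  · rintro ⟨⟨a, b⟩, hz⟩
    rw [mem_PB] at hz
    obtain ⟨v, rfl⟩ := hg b
    obtain ⟨w, hw⟩ := (hex (a - y • v)).1 (by simpa [sub_eq_zero] using hz)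
    obtain ⟨u, rfl⟩ := hh w
    refine ⟨(u, v), ?_⟩
    apply Subtype.ext
    simp [hw]
  · rintro ⟨u, v⟩
    simp only [Set.mem_range, Subtype.ext_iff, LinearMap.codRestrict_apply, LinearMap.comp_apply,
      LinearMap.prod_apply, Prod.ext_iff, ZeroMemClass.coe_zero, Prod.fst_zero,
      Prod.snd_zero, Submodule.subtype_apply]
    constructor
    · rintro ⟨h1, h2⟩
      obtain ⟨w, rfl⟩ := (hex v).1 h2
      refine ⟨⟨(u, -w), ?_⟩, rfl, by simp⟩
      rw [mem_PB]
      apply hi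
      simp only [LinearMap.smul_apply, LinearMap.id_apply, map_neg, map_smul]
      exact eq_neg_of_add_eq_zero_left h1
    · rintro ⟨⟨⟨u', w⟩, hz⟩, rfl, rfl⟩
      rw [mem_PB] at hz
      simp only at hz
      simp [hz, hex.apply_apply_eq_zero]

lemma quot_syz {q : ℕ} (y : R) (hy : IsSMulRegular A y) (g : (Fin q → R) →ₗ[R] A)
    (hg : Function.Surjective g) :
    Syz R (QuotSMulTop y A) (PB g (mulL A y)) := by
  refine ⟨q, LinearMap.fst R _ _ ∘ₗ (PB g (mulL A y)).subtype, (Submodule.mkQ _) ∘ₗ g, ?_,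
    (Submodule.mkQ_surjective _).comp hg, ?_⟩
  · rintro ⟨⟨u, w⟩, hz⟩ ⟨⟨u', w'⟩, hz'⟩ he
    rw [mem_PB] at hz hz'
    obtain rfl : u = u' := he
    obtain rfl : w = w' := hy (hz.symm.trans hz')
    rfl
  · intro u
    simp only [LinearMap.comp_apply, Submodule.mkQ_apply, Submodule.Quotient.mk_eq_zero,
      Submodule.mem_smul_pointwise_iff_exists, Set.mem_range, Submodule.subtype_apply,
      LinearMap.fst_apply]
    constructor
    · rintro ⟨b, -, hb⟩
      exact ⟨⟨(u, b), by rw [mem_PB]; exact hb.symm⟩, rfl⟩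
    · rintro ⟨⟨⟨u', w⟩, hz⟩, rfl⟩
      rw [mem_PB] at hz
      exact ⟨w, trivial, hz.symm⟩

open RingTheory.Sequence in
lemma wr_of_exact (xs : List R) : ∀ {M F K : Type} [AddCommGroup M] [AddCommGroup F]
    [AddCommGroup K] [Module R M] [Module R F] [Module R K] (i : M →ₗ[R] F) (g : F →ₗ[R] K)
    (_ : Function.Injective i) (_ : Function.Surjective g) (_ : Function.Exact i g)
    (_ : IsWeaklyRegular F xs) (_ : IsWeaklyRegular K xs.dropLast), IsWeaklyRegular M xs := by
  induction xs with
  | nil => intros; exact .nil R _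
  | cons x xs ih =>
    intro M F K _ _ _ _ _ _ i g hi hg hex hF hK
    rw [isWeaklyRegular_cons_iff] at hF ⊢
    refine ⟨hF.1.of_injective i hi, ?_⟩
    cases xs with
    | nil => exact .nil R _
    | cons z zs =>
      rw [List.dropLast_cons_of_ne_nil (by simp), isWeaklyRegular_cons_iff] at hK
      refine ih (QuotSMulTop.map x i) (QuotSMulTop.map x g) ?_ (QuotSMulTop.map_surjective x hg)
        (QuotSMulTop.map_exact x hex hg) hF.2 hK.2
      have h0 : Function.Exact (0 : M →ₗ[R] M) i := by
        intro m
        simp only [LinearMap.zero_apply, Set.mem_range, exists_const]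
        rw [map_eq_zero_iff i hi, eq_comm]
      have := QuotSMulTop.map_first_exact_on_four_term_exact_of_isSMulRegular_last h0 hex hK.1
      rw [injective_iff_map_eq_zero]
      intro a ha
      obtain ⟨b, rfl⟩ := (this a).1 ha
      obtain ⟨b, rfl⟩ := Submodule.mkQ_surjective _ b
      simp [QuotSMulTop.map]

open RingTheory.Sequence in
lemma wr_free (xs : List R) (h : IsWeaklyRegular R xs) (q : ℕ) :
    IsWeaklyRegular (Fin q → R) xs :=
  ((TensorProduct.rid R (Fin q → R)).isWeaklyRegular_congr xs).1
    h.isWeaklyRegular_lTensor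

open RingTheory.Sequence in
lemma wr_syz (xs : List R) (h : IsWeaklyRegular R xs) (hs : Syz R A B)
    (hA : IsWeaklyRegular A xs.dropLast) : IsWeaklyRegular B xs := by
  obtain ⟨q, i, g, hi, hg, hex⟩ := hs
  exact wr_of_exact xs i g hi hg hex (wr_free xs h q) hA

end Unbundled

section Bundled

variable {R : Type} [CommRing R]

/-- iterated (not necessarily minimal) syzygies up to stable isomorphism. -/
def GS : ℕ → ModuleCat.{0} R → ModuleCat.{0} R → Prop
  | 0, A, B => SI R A B
  | (n+1), A, B => ∃ K : ModuleCat.{0} R, Syz R A K ∧ GS n K B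

lemma GS.si : ∀ (n : ℕ) {A A' B B' : ModuleCat.{0} R}, GS n A B → GS n A' B' → SI R A A' →
    SI R B B'
  | 0, _, _, _, _, h, h', hA => (SI.symm h).trans (hA.trans h')
  | (n+1), _, _, _, _, ⟨_, hK, h⟩, ⟨_, hK', h'⟩, hA => GS.si n h h' (hK.si hK' hA)

lemma GS.congr_left : ∀ (n : ℕ) {A A' B : ModuleCat.{0} R}, GS n A B → (A ≃ₗ[R] A') → GS n A' B
  | 0, _, _, _, h, e => (SI.of_equiv e).symm.trans h
  | (_+1), _, _, _, ⟨K, hK, h⟩, e => ⟨K, hK.congr_left e, h⟩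

lemma GS.chain : ∀ (n : ℕ) (U : ℕ → ModuleCat.{0} R) (_ : ∀ k, Syz R (U k) (U (k+1))),
    GS n (U 0) (U n)
  | 0, _, _ => SI.of_equiv (LinearEquiv.refl R _)
  | (n+1), U, h => ⟨U 1, h 0, GS.chain n (fun k => U (k+1)) (fun k => h (k+1))⟩

lemma Syz.of_isSyzygyOf [IsLocalRing R] {A B : ModuleCat.{0} R} (h : IsSyzygyOf R A B) :
    Syz R A B := by
  obtain ⟨q, g, hg, -, ⟨e⟩⟩ := h
  have h : Syz R A (LinearMap.ker g) :=
    ⟨q, (LinearMap.ker g).subtype, g, Subtype.val_injective, hg,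
      LinearMap.exact_subtype_ker_map g⟩
  exact h.congr_right e

lemma GS.of_isNth [IsLocalRing R] : ∀ (n : ℕ) {A B : ModuleCat.{0} R}, IsNthSyzygyOf R n A B →
    GS n A B
  | 0, _, _, ⟨e⟩ => SI.of_equiv e.symm
  | (n+1), _, _, ⟨K, hK, h⟩ => ⟨K, Syz.of_isSyzygyOf hK, GS.of_isNth n h⟩

lemma sz_nth [IsLocalRing R] {y : R} : ∀ (n : ℕ) {A B : ModuleCat.{0} R}, IsNthSyzygyOf R n A B →
    SZ A y → SZ B y
  | 0, _, _, ⟨e⟩, h => h.si (SI.of_equiv e.symm)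
  | (n+1), _, _, ⟨_, hK, h⟩, hA => sz_nth n h (hA.syz (Syz.of_isSyzygyOf hK))

lemma finite_nth [IsNoetherianRing R] [IsLocalRing R] : ∀ (n : ℕ) {A B : ModuleCat.{0} R},
    IsNthSyzygyOf R n A B → Module.Finite R A → Module.Finite R B
  | 0, _, _, ⟨e⟩, _ => Module.Finite.equiv e.symm
  | (n+1), _, _, ⟨K, hK, h⟩, _ => by
    refine finite_nth n h ?_
    obtain ⟨q, g, -, -, ⟨e⟩⟩ := hK
    exact Module.Finite.equiv e.symm

open RingTheory.Sequence in
lemma wr_nth [IsLocalRing R] (xs : List R) (hx : IsWeaklyRegular R xs) : ∀ (n j : ℕ)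
    {A B : ModuleCat.{0} R}, IsNthSyzygyOf R n A B → j + n ≤ xs.length →
    IsWeaklyRegular A (xs.take j) → IsWeaklyRegular B (xs.take (j + n))
  | 0, j, _, _, ⟨e⟩, _, h => (e.isWeaklyRegular_congr _).2 h
  | (n+1), j, A, B, ⟨K, hK, h⟩, hj, hA => by
    have := wr_nth xs hx n (j+1) h (by omega) (wr_syz _ ?_ (Syz.of_isSyzygyOf hK) ?_)
    · rwa [show j + (n + 1) = j + 1 + n by omega]
    · rw [← List.take_append_drop (j+1) xs, isWeaklyRegular_append_iff] at hx
      exact hx.1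
    · rw [show (List.take (j+1) xs).dropLast = List.take j xs by
        rw [List.dropLast_eq_take, List.take_take]; congr 1; simp; omega]
      exact hA

variable (R) in
/-- finitely generated modules -/
abbrev FM := {A : ModuleCat.{0} R // Module.Finite R A}

/-- a chosen number of generators -/
noncomputable def rk (A : FM R) : ℕ :=
  haveI := A.2
  (Module.Finite.exists_fin' R A.1).choose

/-- a chosen free cover -/
noncomputable def cov (A : FM R) : (Fin (rk A) → R) →ₗ[R] A.1 :=
  haveI := A.2
  (Module.Finite.exists_fin' R A.1).choose_spec.choose

lemma cov_surj (A : FM R) : Function.Surjective (cov A) :=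
  haveI := A.2
  (Module.Finite.exists_fin' R A.1).choose_spec.choose_spec

variable [IsNoetherianRing R]

/-- the chosen syzygies of a free resolution -/
noncomputable def chn (L : FM R) : ℕ → FM R
  | 0 => L
  | k+1 => ⟨ModuleCat.of R (LinearMap.ker (cov (chn L k))),
      inferInstanceAs (Module.Finite R (LinearMap.ker (cov (chn L k))))⟩

/-- inclusion of the syzygies -/
noncomputable def inc (L : FM R) (k : ℕ) : (chn L (k+1)).1 →ₗ[R] (Fin (rk (chn L k)) → R) :=
  (LinearMap.ker (cov (chn L k))).subtype

lemma inc_inj (L : FM R) (k : ℕ) : Function.Injective (inc L k) := Subtype.val_injective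

lemma inc_exact (L : FM R) (k : ℕ) : Function.Exact (inc L k) (cov (chn L k)) :=
  LinearMap.exact_subtype_ker_map _

lemma chn_syz (L : FM R) (k : ℕ) : Syz R (chn L k).1 (chn L (k+1)).1 :=
  ⟨_, inc L k, cov _, inc_inj L k, cov_surj _, inc_exact L k⟩

lemma step (L : FM R) (y : R) (hy : IsSMulRegular L.1 y) (k : ℕ) (hk : SZ (chn L k).1 y)
    (Z : ModuleCat.{0} R) (hZ : GS (k+1) (ModuleCat.of R (QuotSMulTop y L.1)) Z) :
    SI R Z ((chn L k).1 × (chn L (k+1)).1) := by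
  obtain ⟨s, hs⟩ := hk.lift (cov (chn L k)) (cov_surj _)
  obtain ⟨e⟩ := PB_split (cov (chn L k)) (mulL _ y) (inc L k) (inc_inj L k) (inc_exact L k) s hs
  have h1 : GS (k+1) (ModuleCat.of R (QuotSMulTop y L.1))
      (ModuleCat.of R (PB (cov (chn L k)) (mulL (chn L k).1 y))) := by
    refine ⟨ModuleCat.of R (PB (cov (chn L 0)) (mulL (chn L 0).1 y)), quot_syz y hy (cov (chn L 0)) (cov_surj _), ?_⟩
    exact GS.chain k (fun k => ModuleCat.of R (PB (cov (chn L k)) (mulL (chn L k).1 y)))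
      (fun k => PB_syz y _ (cov_surj _) (inc L k) (inc_inj L k) (inc_exact L k) _ (cov_surj _))
  have h2 := GS.si _ hZ h1 (SI.of_equiv (LinearEquiv.refl R _))
  exact h2.trans (SI.of_equiv (e.symm.trans (LinearEquiv.prodComm R _ _)))


end Bundled

/-- The iterated binomial sum. -/
def DD {R : Type} [CommRing R] : ℕ → (ℕ → ModuleCat.{0} R) → ModuleCat.{0} R
  | 0, V => V 0
  | k+1, V => ModuleCat.of R (DD k V × DD k (fun i => V (i+1)))

section DDs
variable {R : Type} [CommRing R]

lemma DD_syz : ∀ (k : ℕ) (V V' : ℕ → ModuleCat.{0} R) (_ : ∀ i, Syz R (V i) (V' i)),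
    Syz R (DD k V) (DD k V')
  | 0, _, _, h => h 0
  | k+1, V, V', h => (DD_syz k V V' h).prod (DD_syz k _ _ (fun i => h (i+1)))

lemma DD_si : ∀ (k : ℕ) (V V' : ℕ → ModuleCat.{0} R) (_ : ∀ i, SI R (V i) (V' i)),
    SI R (DD k V) (DD k V')
  | 0, _, _, h => h 0
  | k+1, V, V', h => (DD_si k V V' h).prod (DD_si k _ _ (fun i => h (i+1)))

lemma DD_sz {y : R} : ∀ (k : ℕ) (V : ℕ → ModuleCat.{0} R) (_ : ∀ i, SZ (V i) y), SZ (DD k V) y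
  | 0, _, h => h 0
  | k+1, V, h => (DD_sz k V h).prod (DD_sz k _ (fun i => h (i+1)))

open RingTheory.Sequence in
lemma main [IsNoetherianRing R] (M : FM R) (xs : List R) : IsWeaklyRegular M.1 xs →
    (∀ x ∈ xs, SZ M.1 x) → ∀ (Z : ModuleCat.{0} R),
    GS xs.length (ModuleCat.of R (M.1 ⧸ (Ideal.ofList xs • ⊤ : Submodule R M.1))) Z →
    SI R Z (DD xs.length (fun i => (chn M i).1)) := by
  induction xs using List.reverseRecOn with
  | nil =>
    intro _ _ Z hZ
    refine (SI.symm hZ).trans (SI.of_equiv ?_)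
    exact Submodule.quotEquivOfEqBot _ (by simp)
  | append_singleton xs y ih =>
    intro hreg hsz Z hZ
    rw [isWeaklyRegular_append_iff, isWeaklyRegular_singleton_iff] at hreg
    have := M.2
    let L : FM R := ⟨ModuleCat.of R (M.1 ⧸ (Ideal.ofList xs • ⊤ : Submodule R M.1)),
      inferInstanceAs (Module.Finite R (M.1 ⧸ (Ideal.ofList xs • ⊤ : Submodule R M.1)))⟩
    have hU := ih hreg.1 (fun x hx => hsz x (by simp [hx])) (chn L xs.length).1
      (GS.chain xs.length (fun k => (chn L k).1) (chn_syz L))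
    have hszV : ∀ i, SZ (chn M i).1 y := by
      intro i
      induction i with
      | zero => exact hsz y (by simp)
      | succ i ih => exact ih.syz (chn_syz M i)
    have hszU : SZ (chn L xs.length).1 y := (DD_sz _ _ hszV).si hU.symm
    have hU' := (chn_syz L xs.length).si (DD_syz xs.length _ _ (chn_syz M)) hU
    rw [List.length_append, List.length_singleton] at hZ ⊢
    have e : (M.1 ⧸ (Ideal.ofList (xs ++ [y]) • ⊤ : Submodule R M.1)) ≃ₗ[R]
        QuotSMulTop y (M.1 ⧸ (Ideal.ofList xs • ⊤ : Submodule R M.1)) :=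
      (Submodule.quotEquivOfEq _ _ (by
        rw [Ideal.ofList_append, Ideal.ofList_cons y xs, Ideal.ofList_singleton, sup_comm])).trans
        (Submodule.quotOfListConsSMulTopEquivQuotSMulTopOuter M.1 y xs)
    have := step L y hreg.2 xs.length hszU Z (GS.congr_left _ hZ e)
    exact this.trans (hU.prod hU')

/-- splitting off index zero -/
def piNat (W : ℕ → Type) [∀ i, AddCommGroup (W i)] [∀ i, Module R (W i)] :
    ((i : ℕ) → W i) ≃ₗ[R] (W 0 × ((i : ℕ) → W (i+1))) where
  toFun f := (f 0, fun i => f (i+1))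
  invFun p := fun i => match i with
    | 0 => p.1
    | i+1 => p.2 i
  map_add' _ _ := rfl
  map_smul' _ _ := rfl
  left_inv f := by ext i; cases i <;> rfl
  right_inv p := rfl

/-- products of pi types -/
def piProd (ι : Type) (V W : ι → Type) [∀ i, AddCommGroup (W i)] [∀ i, Module R (W i)]
    [∀ i, AddCommGroup (V i)] [∀ i, Module R (V i)] :
    ((i : ι) → V i × W i) ≃ₗ[R] (((i : ι) → V i) × ((i : ι) → W i)) where
  toFun f := (fun i => (f i).1, fun i => (f i).2)
  invFun p := fun i => (p.1 i, p.2 i)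
  map_add' _ _ := rfl
  map_smul' _ _ := rfl
  left_inv _ := rfl
  right_inv _ := rfl

lemma DD_equiv : ∀ (k : ℕ) (V : ℕ → ModuleCat.{0} R),
    Nonempty (DD k V ≃ₗ[R] ((i : ℕ) → Fin (k.choose i) → V i))
  | 0, V => by
    refine ⟨?_⟩
    suffices h : (DD 0 V) ≃ₗ[R] ((Fin (Nat.choose 0 0) → V 0) × ((i : ℕ) → Fin (Nat.choose 0 (i+1)) → V (i+1))) from
      h.trans (piNat (R := R) (fun i => Fin (Nat.choose 0 i) → V i)).symm
    haveI : ∀ i, Subsingleton (Fin (Nat.choose 0 (i+1)) → V (i+1)) := fun i => by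
      rw [Nat.choose_zero_succ]; infer_instance
    haveI : Unique ((i : ℕ) → Fin (Nat.choose 0 (i+1)) → V (i+1)) :=
      ⟨⟨0⟩, fun a => Subsingleton.elim _ _⟩
    exact (LinearEquiv.funUnique (Fin 1) R (V 0)).symm.trans (LinearEquiv.prodUnique).symm
  | k+1, V => by
    obtain ⟨e⟩ := DD_equiv k V
    obtain ⟨e'⟩ := DD_equiv k (fun i => V (i+1))
    refine ⟨ltr (A := DD k V × DD k (fun i => V (i+1))) (e.prodCongr e') ?_⟩
    refine ltr ?_ (piNat (R := R) (fun i => Fin (Nat.choose (k+1) i) → V i)).symm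
    refine ltr ((piNat (R := R) (fun i => Fin (Nat.choose k i) → V i)).prodCongr
      (LinearEquiv.refl R _)) ?_
    refine ltr (LinearEquiv.prodAssoc R _ _ _) ?_
    refine LinearEquiv.prodCongr (LinearEquiv.funCongrLeft R (V 0)
      (finCongr (by simp))) ?_
    refine ltr (piProd (R := R) ℕ _ _).symm (LinearEquiv.piCongrRight fun i => ?_)
    refine ltr (LinearEquiv.prodComm R _ _) ?_
    refine ltr (LinearEquiv.sumArrowLequivProdArrow (Fin (k.choose i)) (Fin (k.choose (i+1))) R
      (V (i+1))).symm ?_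
    exact LinearEquiv.funCongrLeft R (V (i+1))
      ((finCongr (Nat.choose_succ_succ k i)).trans (finSumFinEquiv (m := k.choose i)).symm)

/-- restricting to a finite range of indices outside which everything vanishes -/
lemma pi_restrict (n : ℕ) (W : ℕ → Type) [∀ i, AddCommGroup (W i)] [∀ i, Module R (W i)]
    (h : ∀ i, n ≤ i → Subsingleton (W i)) :
    Nonempty (((i : ℕ) → W i) ≃ₗ[R] ((i : Fin n) → W i)) := by
  refine ⟨LinearEquiv.ofBijective (LinearMap.pi fun i : Fin n => LinearMap.proj (i : ℕ)) ⟨?_, ?_⟩⟩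
  · intro f g hfg
    ext i
    by_cases hi : i < n
    · exact congrFun hfg ⟨i, hi⟩
    · have := h i (by omega)
      exact Subsingleton.elim _ _
  · intro f
    refine ⟨fun i => if hi : i < n then f ⟨i, hi⟩ else 0, ?_⟩
    ext i
    simp

end DDs

section ExtPart
variable {R : Type} [CommRing R]

lemma cocycle (P : ChainComplex (ModuleCat.{0} R) ℕ) (K : ModuleCat.{0} R) (x : R)
    (h : ∀ e : (P.linearYonedaObj R K).homology 1, x • e = 0) (c : P.X 1 ⟶ K)
    (hc : P.d 2 1 ≫ c = 0) : ∃ b : P.X 0 ⟶ K, P.d 1 0 ≫ b = x • c := by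
  let S := (P.linearYonedaObj R K).sc' 0 1 2
  let i : (P.linearYonedaObj R K).sc 1 ≅ S :=
    (P.linearYonedaObj R K).isoSc' 0 1 2 (by simp) (by simp)
  let j : (P.linearYonedaObj R K).homology 1 ≅ S.moduleCatLeftHomologyData.H :=
    ShortComplex.homologyMapIso i ≪≫ S.moduleCatHomologyIso
  have h' : ∀ e : S.moduleCatLeftHomologyData.H, x • e = 0 := by
    intro e
    have := congrArg j.hom.hom (h (j.inv.hom e))
    rw [map_smul, map_zero] at this
    simpa using this
  let c' : LinearMap.ker S.g.hom := ⟨c, hc⟩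
  have h2 : (Submodule.Quotient.mk (x • c') :
      LinearMap.ker S.g.hom ⧸ LinearMap.range S.moduleCatToCycles) = 0 :=
    h' (Submodule.Quotient.mk c')
  obtain ⟨b, hb⟩ := (Submodule.Quotient.mk_eq_zero _).1 h2
  exact ⟨b, congrArg Subtype.val hb⟩

lemma SZ_of_ext (N K : ModuleCat.{0} R) (h : Syz R N K) (x : R) (hx : SMulExtZero R x 1 N K) :
    SZ N x := by
  obtain ⟨q, i, g, hi, hg, hex⟩ := h
  let P := ProjectiveResolution.of N
  let j := P.isoExt (R := R) 1 K
  have hP : ∀ e : (P.complex.linearYonedaObj R K).homology 1, x • e = 0 := by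
    intro e
    have := congrArg j.hom.hom (hx (j.inv.hom e))
    have hj : j.hom.hom (j.inv.hom e) = e := by simp
    rw [map_smul, map_zero, hj] at this
    exact this
  let p : P.complex.X 0 ⟶ N := P.π.f 0
  have hp : Function.Surjective p.hom :=
    (ModuleCat.epi_iff_surjective _).1 (inferInstanceAs (Epi (P.π.f 0)))
  have hpd : ∀ z, p.hom ((P.complex.d 1 0).hom z) = 0 := fun z =>
    LinearMap.congr_fun (congrArg ModuleCat.Hom.hom P.complex_d_comp_π_f_zero) z
  have hpe : ∀ z, p.hom z = 0 → ∃ w, (P.complex.d 1 0).hom w = z :=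
    (ShortComplex.moduleCat_exact_iff _).1 P.exact₀
  let G : ModuleCat.of R (Fin q → R) ⟶ N := ModuleCat.ofHom g
  haveI : Epi G := (ModuleCat.epi_iff_surjective _).2 hg
  haveI : Projective (P.complex.X 0) := P.projective 0
  let t : P.complex.X 0 ⟶ ModuleCat.of R (Fin q → R) := Projective.factorThru p G
  have ht : ∀ z, g (t.hom z) = p.hom z := fun z =>
    LinearMap.congr_fun (congrArg ModuleCat.Hom.hom (Projective.factorThru_comp p G)) z
  have hmem : ∀ z, t.hom ((P.complex.d 1 0).hom z) ∈ LinearMap.range i := by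
    intro z
    exact (hex _).1 (by rw [ht, hpd])
  let e := LinearEquiv.ofInjective i hi
  let c : P.complex.X 1 →ₗ[R] K :=
    e.symm.toLinearMap ∘ₗ LinearMap.codRestrict _ (t.hom ∘ₗ (P.complex.d 1 0).hom) hmem
  have hc : ∀ z, i (c z) = t.hom ((P.complex.d 1 0).hom z) := by
    intro z
    have : e (c z) = ⟨t.hom ((P.complex.d 1 0).hom z), hmem z⟩ := by
      simp [c]; rfl
    exact congrArg Subtype.val this
  obtain ⟨b, hb⟩ := cocycle P.complex K x hP (ModuleCat.ofHom c) (by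
    ext z
    apply hi
    have h0 : (P.complex.d 1 0).hom ((P.complex.d 2 1).hom z) = 0 :=
      LinearMap.congr_fun (congrArg ModuleCat.Hom.hom (P.complex.d_comp_d 2 1 0)) z
    change i (c ((P.complex.d 2 1).hom z)) = i 0
    rw [hc, h0, map_zero, map_zero])
  have hb' : ∀ z, b.hom ((P.complex.d 1 0).hom z) = x • c z := fun z =>
    LinearMap.congr_fun (congrArg ModuleCat.Hom.hom hb) z
  let f : P.complex.X 0 →ₗ[R] (Fin q → R) := x • t.hom - i ∘ₗ b.hom
  have hf : LinearMap.ker p.hom ≤ LinearMap.ker f := by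
    intro z hz
    obtain ⟨w, rfl⟩ := hpe z hz
    rw [LinearMap.mem_ker]
    change x • t.hom ((P.complex.d 1 0).hom w) - i (b.hom ((P.complex.d 1 0).hom w)) = 0
    rw [hb', map_smul, hc, sub_self]
  let s : N →ₗ[R] (Fin q → R) :=
    (LinearMap.ker p.hom).liftQ f hf ∘ₗ (p.hom.quotKerEquivOfSurjective hp).symm.toLinearMap
  have hs : ∀ z, s (p.hom z) = f z := by
    intro z
    have : (p.hom.quotKerEquivOfSurjective hp).symm (p.hom z) = Submodule.Quotient.mk z := by
      rw [LinearEquiv.symm_apply_eq]; rfl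
    simp only [s, LinearMap.comp_apply, LinearEquiv.coe_coe]
    rw [this, Submodule.liftQ_apply]
  refine ⟨q, s, g, fun z => ?_⟩
  obtain ⟨z, rfl⟩ := hp z
  rw [hs]
  change g (x • t.hom z - i (b.hom z)) = _
  rw [map_sub, map_smul, ht, hex.apply_apply_eq_zero, sub_zero]

end ExtPart

end SyzAux

/-- Corollary 4.4: `Ω^n(M/(x₁,…,xₙ)M) ≅ ⊕_{i=0}^{n} (Ω^i M)^{C(n,i)}`
up to free direct summands. -/
theorem nth_syzygy_of_quotient_stably_iso
    (R : Type) [CommRing R] [IsNoetherianRing R] [IsLocalRing R]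
    (N : ModuleCat.{0} R) [Module.Finite R N] [Nontrivial N]
    (n : ℕ) (hn : 1 ≤ n)
    (M : ModuleCat.{0} R) (hM : IsNthSyzygyOf R n N M)
    (xs : List R) (hlen : xs.length = n)
    (hreg : RingTheory.Sequence.IsRegular R xs)
    (ΩN : ModuleCat.{0} R) (hΩ : IsSyzygyOf R N ΩN)
    (hann : ∀ x ∈ xs, SMulExtZero R x 1 N ΩN)
    (W : Fin (n+1) → ModuleCat.{0} R)
    (hW : ∀ i : Fin (n+1), IsNthSyzygyOf R (i : ℕ) M (W i))
    (Z : ModuleCat.{0} R)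
    (hZ : IsNthSyzygyOf R n
      (ModuleCat.of R (↥M ⧸ (Ideal.ofList xs • ⊤ : Submodule R ↥M))) Z) :
    StablyIso R Z (ModuleCat.of R ((i : Fin (n+1)) → Fin (n.choose i) → ↥(W i))) := by
  classical
  have hNx : ∀ x ∈ xs, SyzAux.SZ N x := fun x hx =>
    SyzAux.SZ_of_ext N ΩN (SyzAux.Syz.of_isSyzygyOf hΩ) x (hann x hx)
  let M' : SyzAux.FM R := ⟨M, SyzAux.finite_nth n hM inferInstance⟩
  have hwr : RingTheory.Sequence.IsWeaklyRegular M xs := by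
    have := SyzAux.wr_nth xs hreg.toIsWeaklyRegular n 0 hM (by omega) (by simp)
    rwa [zero_add, List.take_of_length_le hlen.le] at this
  have h1 := SyzAux.main M' xs hwr (fun x hx => SyzAux.sz_nth n hM (hNx x hx)) Z
    (by rw [hlen]; exact SyzAux.GS.of_isNth n hZ)
  rw [hlen] at h1
  let W' : ℕ → ModuleCat.{0} R := fun i =>
    if h : i < n + 1 then W ⟨i, h⟩ else (SyzAux.chn M' i).1
  have hW' : ∀ i : Fin (n+1), W' i = W i := fun i => by simp only [W', dif_pos i.2]
  have h2 : SyzAux.SI R (SyzAux.DD n (fun i => (SyzAux.chn M' i).1)) (SyzAux.DD n W') := by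
    refine SyzAux.DD_si n _ _ (fun i => ?_)
    by_cases h : i < n + 1
    · have e : W' i = W ⟨i, h⟩ := hW' ⟨i, h⟩
      rw [e]
      exact SyzAux.GS.si i
        (SyzAux.GS.chain i (fun k => (SyzAux.chn M' k).1) (SyzAux.chn_syz M'))
        (SyzAux.GS.of_isNth i (hW ⟨i, h⟩)) (SyzAux.SI.of_equiv (LinearEquiv.refl R _))
    · have e : W' i = (SyzAux.chn M' i).1 := by simp only [W', dif_neg h]
      rw [e]
      exact SyzAux.SI.of_equiv (LinearEquiv.refl R _)
  obtain ⟨e1⟩ := SyzAux.DD_equiv n W'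
  obtain ⟨e2⟩ := SyzAux.pi_restrict (R := R) (n+1) (fun i => Fin (n.choose i) → W' i)
    (fun i hi => by rw [Nat.choose_eq_zero_of_lt hi]; infer_instance)
  have e3 : ((i : Fin (n+1)) → Fin (n.choose i) → W' i) ≃ₗ[R]
      ((i : Fin (n+1)) → Fin (n.choose i) → W i) :=
    LinearEquiv.piCongrRight fun i => LinearEquiv.piCongrRight fun _ =>
      (eqToIso (hW' i)).toLinearEquiv
  exact (h1.trans h2).trans (SyzAux.SI.of_equiv (e1.trans (e2.trans e3)))
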